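/- Let 1 ≤ p ≤ 2 and let ψ be a Lipschitz continuous function with compact support contained in the closed unit ball minus the origin, B̄₁∖{0}. If μ, ν ∈ 𝕃_p(B₁), then |∫_{B₁} ψ dμ − ∫_{B₁} ψ dν| ≤ (μ(spt ψ) + ν(spt ψ))^{(p−1)/p} [ψ]_Lip d_{𝕃_p}(μ,ν), where [ψ]_Lip is the Lipschitz constant of ψ. -/

import Mathlib

open MeasureTheory Set Metric Filter
open scoped ENNReal NNReal

noncomputable section

abbrev Euc (d : ℕ) := EuclideanSpace ℝ (Fin d)

variable {d : ℕ} {A B : Type*}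

/-- `μ ∈ 𝕃_p(ℝ^d)`: a positive Borel measure on `ℝ^d ∖ {0}` (modeled as a measure on `ℝ^d`
vanishing on `{0}`) with `N_p(μ) = ∫ min(1,|z|^p) dμ < ∞`. -/
def IsLevyLp (p : ℝ) (μ : Measure (Euc d)) : Prop :=
  μ {0} = 0 ∧ ∫⁻ z, ENNReal.ofReal (min 1 (‖z‖ ^ p)) ∂μ < ⊤

/-- `μ ∈ 𝕃_p(Ω)`: member of `𝕃_p(ℝ^d)` giving no mass to the complement of `Ω`. -/
def IsLevyLpOn (p : ℝ) (Ω : Set (Euc d)) (μ : Measure (Euc d)) : Prop :=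
  IsLevyLp p μ ∧ μ Ωᶜ = 0

/-- `μ ∈ M_p(ℝ^d)`: Lévy measure with finite `p`-moment. -/
def IsMp (p : ℝ) (μ : Measure (Euc d)) : Prop :=
  IsLevyLp p μ ∧ ∫⁻ z, ENNReal.ofReal (‖z‖ ^ p) ∂μ < ⊤

/-- Admissible transport plans between `μ₁` and `μ₂`: positive Borel measures on `ℝ^d × ℝ^d`
with no mass at `(0,0)` whose marginals, restricted to `ℝ^d ∖ {0}`, are `μ₁` and `μ₂`. -/
def AdmPlan (μ₁ μ₂ : Measure (Euc d)) : Set (Measure (Euc d × Euc d)) :=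
  {γ | γ {((0 : Euc d), (0 : Euc d))} = 0 ∧
       (γ.map Prod.fst).restrict {(0 : Euc d)}ᶜ = μ₁ ∧
       (γ.map Prod.snd).restrict {(0 : Euc d)}ᶜ = μ₂}

/-- The transport cost functional `J_p(γ) = ∫ |x-y|^p dγ`. -/
def Jp (p : ℝ) (γ : Measure (Euc d × Euc d)) : ℝ≥0∞ :=
  ∫⁻ q, ENNReal.ofReal (‖q.1 - q.2‖ ^ p) ∂γ

/-- `d_{𝕃_p}(μ,ν)^p` as an extended nonnegative real. -/
def dLpPow (p : ℝ) (μ ν : Measure (Euc d)) : ℝ≥0∞ :=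
  ⨅ γ ∈ AdmPlan μ ν, Jp p γ

/-- The transport distance `d_{𝕃_p}`. -/
def dLp (p : ℝ) (μ ν : Measure (Euc d)) : ℝ :=
  (dLpPow p μ ν).toReal ^ (1 / p)

/-- Total variation distance `|μ - ν|(X)` between two positive measures. -/
def dTV {X : Type*} [MeasurableSpace X] (μ ν : Measure X) : ℝ≥0∞ :=
  (⨆ (s : Set X) (_ : MeasurableSet s), μ s - ν s) +
  (⨆ (s : Set X) (_ : MeasurableSet s), ν s - μ s)

/-- A modulus of continuity. -/
def IsModulus (θ : ℝ → ℝ) : Prop :=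
  (∀ r, 0 ≤ θ r) ∧ Monotone θ ∧ Tendsto θ (nhdsWithin 0 (Ioi 0)) (nhds 0)

/-- Bounded uniformly continuous functions on `ℝ^d`. -/
def IsBUC (u : Euc d → ℝ) : Prop :=
  (∃ M, ∀ x, |u x| ≤ M) ∧ UniformContinuous u

/-- The Lévy operator `L_μ(φ,x) = ∫ [φ(x+z) - φ(x) - χ_{B₁}(z) Dφ(x)·z] dμ(z)`. -/
def Lop (μ : Measure (Euc d)) (φ : Euc d → ℝ) (x : Euc d) : ℝ :=
  ∫ z, (φ (x + z) - φ x -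
    (ball (0 : Euc d) 1).indicator (fun w => fderiv ℝ φ x w) z) ∂μ

/-- The operator `I(φ,x) = sup_α inf_β { -L^{αβ}(φ,x) + c_{αβ}(x) φ(x) + f_{αβ}(x) }`. -/
def Iop (μf : Euc d → A → B → Measure (Euc d)) (c f : A → B → Euc d → ℝ)
    (φ : Euc d → ℝ) (x : Euc d) : ℝ :=
  ⨆ α : A, ⨅ β : B, (-(Lop (μf x α β) φ x) + c α β x * φ x + f α β x)

/-- Viscosity subsolution of `J(u,x) = 0` in `O`. -/
def IsSubsolution (O : Set (Euc d)) (J : (Euc d → ℝ) → Euc d → ℝ) (u : Euc d → ℝ) : Prop :=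
  ∀ φ : Euc d → ℝ, ContDiff ℝ 2 φ → (∃ M, ∀ x, |φ x| ≤ M) →
    ∀ x ∈ O, (∀ y, u y - φ y ≤ u x - φ x) → φ x = u x → J φ x ≤ 0

/-- Viscosity supersolution of `J(u,x) = 0` in `O`. -/
def IsSupersolution (O : Set (Euc d)) (J : (Euc d → ℝ) → Euc d → ℝ) (u : Euc d → ℝ) : Prop :=
  ∀ φ : Euc d → ℝ, ContDiff ℝ 2 φ → (∃ M, ∀ x, |φ x| ≤ M) →
    ∀ x ∈ O, (∀ y, u x - φ x ≤ u y - φ y) → φ x = u x → 0 ≤ J φ x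

/-- Assumption A, stated for a family `νhat` (the parts of the Lévy measures near the origin):
Lipschitz continuity in the transport metric `d_{𝕃_p}`. -/
def AssumptionA (O : Set (Euc d)) (p : ℝ) (νhat : Euc d → A → B → Measure (Euc d)) : Prop :=
  ∃ C : ℝ, 0 ≤ C ∧ ∀ x ∈ O, ∀ y ∈ O, ∀ (α : A) (β : B),
    dLp p (νhat x α β) (νhat y α β) ≤ C * ‖x - y‖

/-- Assumption A1: `s`-Hölder continuity in the transport metric `d_{𝕃_p}`. -/
def AssumptionA1 (O : Set (Euc d)) (p s : ℝ) (νhat : Euc d → A → B → Measure (Euc d)) : Prop :=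
  ∃ C : ℝ, 0 < C ∧ ∀ x ∈ O, ∀ y ∈ O, ∀ (α : A) (β : B),
    dLp p (νhat x α β) (νhat y α β) ≤ C * ‖x - y‖ ^ s

/-- Assumption B: continuity in total variation of the tails. -/
def AssumptionB (O : Set (Euc d)) (νcheck : Euc d → A → B → Measure (Euc d)) : Prop :=
  ∃ θ : ℝ → ℝ, IsModulus θ ∧ ∀ x ∈ O, ∀ y ∈ O, ∀ (α : A) (β : B),
    dTV (νcheck x α β) (νcheck y α β) ≤ ENNReal.ofReal (θ ‖x - y‖)

/-- Assumption C: equicontinuity and uniform boundedness of `f_{αβ}`. -/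
def AssumptionC (O : Set (Euc d)) (f : A → B → Euc d → ℝ) : Prop :=
  ∃ θ : ℝ → ℝ, IsModulus θ ∧ ∃ C : ℝ, 0 ≤ C ∧
    (∀ x ∈ O, ∀ y ∈ O, ∀ (α : A) (β : B), |f α β x - f α β y| ≤ θ ‖x - y‖) ∧
    (∀ x ∈ O, ∀ (α : A) (β : B), |f α β x| ≤ C)

/-- Assumption D: `0 < λ ≤ c_{αβ} ≤ λ₁` and equicontinuity of `c_{αβ}`. -/
def AssumptionD (O : Set (Euc d)) (c : A → B → Euc d → ℝ) : Prop :=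
  ∃ lam lam1 : ℝ, 0 < lam ∧ lam ≤ lam1 ∧
    (∀ x ∈ O, ∀ (α : A) (β : B), lam ≤ c α β x ∧ c α β x ≤ lam1) ∧
    ∃ θ : ℝ → ℝ, IsModulus θ ∧
      ∀ x ∈ O, ∀ y ∈ O, ∀ (α : A) (β : B), |c α β x - c α β y| ≤ θ ‖x - y‖

/-- Assumption E: uniform integrability of the Lévy measures. -/
def AssumptionE (O : Set (Euc d)) (p : ℝ) (μf : Euc d → A → B → Measure (Euc d)) : Prop :=
  (∃ θ : ℝ → ℝ, IsModulus θ ∧ ∀ r : ℝ, 0 < r → ∀ x ∈ O, ∀ (α : A) (β : B),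
      ∫⁻ z in ball (0 : Euc d) r, ENNReal.ofReal (‖z‖ ^ p) ∂(μf x α β) ≤ ENNReal.ofReal (θ r)) ∧
  (∃ Λ : ℝ, 0 ≤ Λ ∧ ∀ x ∈ O, ∀ (α : A) (β : B),
      ∫⁻ z, ENNReal.ofReal (min 1 (‖z‖ ^ p)) ∂(μf x α β) ≤ ENNReal.ofReal Λ)

/-- The smooth approximation `ψ_κ(x) = (κ + |x|²)^{p/2} - κ^{p/2}` of `|x|^p`. -/
def psiK (p κ : ℝ) (x : Euc d) : ℝ := (κ + ‖x‖ ^ 2) ^ (p / 2) - κ ^ (p / 2)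

/-- `u` is pointwise-`C^{1,1}` at `x₀`. -/
def PointwiseC11 (u : Euc d → ℝ) (x₀ : Euc d) : Prop :=
  DifferentiableAt ℝ u x₀ ∧ ∃ C : ℝ, 0 < C ∧ ∀ᶠ x in nhds x₀,
    |u x - u x₀ - fderiv ℝ u x₀ (x - x₀)| ≤ C * ‖x - x₀‖ ^ 2

/-- Sup-convolution `u^δ`. -/
def supConv (δ : ℝ) (u : Euc d → ℝ) (x : Euc d) : ℝ :=
  ⨆ y : Euc d, (u y - ‖x - y‖ ^ 2 / δ)

/-- Inf-convolution `v_δ`. -/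
def infConv (δ : ℝ) (v : Euc d → ℝ) (x : Euc d) : ℝ :=
  ⨅ y : Euc d, (v y + ‖x - y‖ ^ 2 / δ)

/-- `(φ,ψ) ∈ Adm^p`, the admissible pairs for the dual problem. -/
def AdmPair (p : ℝ) (μ₁ μ₂ : Measure (Euc d)) (φ ψ : Euc d → ℝ) : Prop :=
  Integrable φ μ₁ ∧ Integrable ψ μ₂ ∧
  UpperSemicontinuous φ ∧ UpperSemicontinuous ψ ∧
  φ 0 = 0 ∧ ψ 0 = 0 ∧ ∀ x y : Euc d, φ x + ψ y ≤ ‖x - y‖ ^ p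

lemma measure_lt_top_of_isCompact_of_isLevyLp {d : ℕ} {p : ℝ} (hp : 0 ≤ p)
    {μ : Measure (Euc d)} (hμ : IsLevyLp p μ) {S : Set (Euc d)} (hS : IsCompact S)
    (h0 : (0 : Euc d) ∉ S) : μ S < ⊤ := by
  rcases S.eq_empty_or_nonempty with rfl | hne
  · simp
  obtain ⟨z₀, hz₀, hmin⟩ := hS.exists_isMinOn hne continuous_norm.continuousOn
  have hz₀pos : 0 < ‖z₀‖ := norm_pos_iff.2 fun h => h0 (h ▸ hz₀)
  have hc : 0 < min 1 (‖z₀‖ ^ p) := lt_min one_pos (Real.rpow_pos_of_pos hz₀pos p)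
  have hle : ENNReal.ofReal (min 1 (‖z₀‖ ^ p)) * μ S ≤
      ∫⁻ z, ENNReal.ofReal (min 1 (‖z‖ ^ p)) ∂μ := by
    rw [← setLIntegral_const]
    refine (setLIntegral_mono_ae' hS.measurableSet (.of_forall fun z hz => ?_)).trans
      (setLIntegral_le_lintegral S _)
    have hz : ‖z₀‖ ≤ ‖z‖ := hmin hz
    gcongr
  refine lt_of_le_of_ne le_top fun htop => ?_
  rw [htop, ENNReal.mul_top (by simpa using hc)] at hle
  exact hμ.2.not_ge hle

lemma lintegral_norm_rpow_lt_top {d : ℕ} {p : ℝ} (hp : 0 ≤ p) {μ : Measure (Euc d)}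
    (hμ : IsLevyLpOn p (ball (0 : Euc d) 1) μ) :
    ∫⁻ z, ENNReal.ofReal (‖z‖ ^ p) ∂μ < ⊤ := by
  refine lt_of_le_of_lt (lintegral_mono_ae ?_) hμ.1.2
  have hball : ∀ᵐ z ∂μ, z ∈ ball (0 : Euc d) 1 := hμ.2
  filter_upwards [hball] with z hz
  rw [min_eq_right (Real.rpow_le_one (norm_nonneg z) (mem_ball_zero_iff.1 hz).le hp)]

/-- The plan sending all of the mass of both measures to the origin has finite cost. -/
lemma dLpPow_lt_top {d : ℕ} {p : ℝ} (hp : 0 ≤ p) {μ ν : Measure (Euc d)}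
    (hμ : IsLevyLpOn p (ball (0 : Euc d) 1) μ) (hν : IsLevyLpOn p (ball (0 : Euc d) 1) ν) :
    dLpPow p μ ν < ⊤ := by
  have hl : Measurable fun x : Euc d => (x, (0 : Euc d)) := by fun_prop
  have hr : Measurable fun y : Euc d => ((0 : Euc d), y) := by fun_prop
  have hcost : Measurable fun q : Euc d × Euc d => ENNReal.ofReal (‖q.1 - q.2‖ ^ p) := by
    fun_prop
  have hrestrict : ∀ {ρ : Measure (Euc d)}, ρ {0} = 0 → ρ.restrict {(0 : Euc d)}ᶜ = ρ :=
    fun h => Measure.restrict_eq_self_of_ae_mem (measure_eq_zero_iff_ae_notMem.1 h)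
  have hzero : ∀ ρ : Measure (Euc d),
      (ρ.map fun _ => (0 : Euc d)).restrict {(0 : Euc d)}ᶜ = 0 := fun ρ => by
    simp [Measure.map_const]
  have hadm : μ.map (fun x => (x, (0 : Euc d))) + ν.map (fun y => ((0 : Euc d), y)) ∈
      AdmPlan μ ν := by
    refine ⟨?_, ?_, ?_⟩
    · rw [Measure.add_apply, Measure.map_apply hl (measurableSet_singleton _),
        Measure.map_apply hr (measurableSet_singleton _)]
      have h₁ : (fun x : Euc d => (x, (0 : Euc d))) ⁻¹' {(0, 0)} = {0} := by ext; simp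
      have h₂ : (fun y : Euc d => ((0 : Euc d), y)) ⁻¹' {(0, 0)} = {0} := by ext; simp
      rw [h₁, h₂, hμ.1.1, hν.1.1, add_zero]
    · rw [Measure.map_add _ _ measurable_fst, Measure.map_map measurable_fst hl,
        Measure.map_map measurable_fst hr, Measure.restrict_add]
      have h := hzero ν
      have h' := hrestrict hμ.1.1
      simp only [Function.comp_def, Measure.map_id'] at h ⊢
      rw [h, h', add_zero]
    · rw [Measure.map_add _ _ measurable_snd, Measure.map_map measurable_snd hl,
        Measure.map_map measurable_snd hr, Measure.restrict_add]
      have h := hzero μ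
      have h' := hrestrict hν.1.1
      simp only [Function.comp_def, Measure.map_id'] at h ⊢
      rw [h, h', zero_add]
  refine (iInf₂_le _ hadm).trans_lt ?_
  rw [Jp, lintegral_add_measure, lintegral_map hcost hl, lintegral_map hcost hr]
  simpa using ENNReal.add_lt_top.2
    ⟨lintegral_norm_rpow_lt_top hp hμ, lintegral_norm_rpow_lt_top hp hν⟩

/-- A function vanishing at the origin has the same integral against a measure and against any
push-forward agreeing with it off the origin. -/
lemma integrable_comp_and_integral_eq {d : ℕ} {X : Type*} [MeasurableSpace X]
    {γ : Measure X} {π : X → Euc d} (hπ : Measurable π) {μ : Measure (Euc d)}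
    (hγ : (γ.map π).restrict {(0 : Euc d)}ᶜ = μ) {ψ : Euc d → ℝ} (hψ : Continuous ψ)
    (h0 : ψ 0 = 0) (hint : Integrable ψ μ) :
    Integrable (fun q => ψ (π q)) γ ∧ ∫ z, ψ z ∂μ = ∫ q, ψ (π q) ∂γ := by
  have hsupp : ∀ z, z ∉ ({0}ᶜ : Set (Euc d)) → ψ z = 0 := fun z hz => by
    have : z = 0 := by simpa using hz
    rw [this, h0]
  subst hγ
  refine ⟨?_, ?_⟩
  · have h : Integrable ψ (γ.map π) :=
      (integrableOn_iff_integrable_of_support_subset fun z hz =>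
        by_contra fun h => hz (hsupp z h)).1 hint
    exact h.comp_measurable hπ
  · rw [setIntegral_eq_integral_of_forall_compl_eq_zero hsupp,
      integral_map hπ.aemeasurable hψ.aestronglyMeasurable]

lemma setLIntegral_norm_sub_le {d : ℕ} {p : ℝ} (hp : 1 ≤ p) (γ : Measure (Euc d × Euc d))
    (E : Set (Euc d × Euc d)) :
    ∫⁻ q in E, ‖q.1 - q.2‖ₑ ∂γ ≤ Jp p γ ^ (1 / p) * γ E ^ ((p - 1) / p) := by
  have hp0 : 0 < p := by linarith
  have h := eLpNorm'_le_eLpNorm'_mul_rpow_measure_univ (μ := γ.restrict E) one_pos hp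
    (f := fun q : Euc d × Euc d => q.1 - q.2) (by fun_prop)
  have hexp : 1 - 1 / p = (p - 1) / p := by field_simp
  simp only [eLpNorm', Measure.restrict_apply_univ, ENNReal.rpow_one, div_one, hexp] at h
  refine h.trans ?_
  gcongr
  refine (setLIntegral_le_lintegral E _).trans (lintegral_mono fun q => ?_)
  rw [← ENNReal.ofReal_rpow_of_nonneg (norm_nonneg _) hp0.le, ofReal_norm]

lemma measure_preimage_eq_of_restrict_map_eq {d : ℕ} {X : Type*} [MeasurableSpace X]
    {γ : Measure X} {π : X → Euc d} (hπ : Measurable π) {μ : Measure (Euc d)}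
    (hγ : (γ.map π).restrict {(0 : Euc d)}ᶜ = μ) {S : Set (Euc d)} (hS : MeasurableSet S)
    (h0 : (0 : Euc d) ∉ S) : γ (π ⁻¹' S) = μ S := by
  have hsub : S ⊆ {(0 : Euc d)}ᶜ := subset_compl_singleton_iff.2 h0
  rw [← hγ, Measure.restrict_apply hS, inter_eq_left.2 hsub, Measure.map_apply hπ hS]

lemma enorm_integral_sub_le_of_mem_admPlan {d : ℕ} {p : ℝ} (hp : 1 ≤ p) {ψ : Euc d → ℝ}
    {K : ℝ≥0} (hψ : LipschitzWith K ψ) (h0 : (0 : Euc d) ∉ tsupport ψ)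
    {μ ν : Measure (Euc d)} (hμ : Integrable ψ μ) (hν : Integrable ψ ν)
    {γ : Measure (Euc d × Euc d)} (hγ : γ ∈ AdmPlan μ ν) :
    ‖(∫ z, ψ z ∂μ) - ∫ z, ψ z ∂ν‖ₑ ≤
      (μ (tsupport ψ) + ν (tsupport ψ)) ^ ((p - 1) / p) * K * Jp p γ ^ (1 / p) := by
  obtain ⟨-, h₁, h₂⟩ := hγ
  have hψ0 : ψ 0 = 0 := image_eq_zero_of_notMem_tsupport h0
  have hS : MeasurableSet (tsupport ψ) := (isClosed_tsupport ψ).measurableSet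
  obtain ⟨hi₁, he₁⟩ := integrable_comp_and_integral_eq measurable_fst h₁ hψ.continuous hψ0 hμ
  obtain ⟨hi₂, he₂⟩ := integrable_comp_and_integral_eq measurable_snd h₂ hψ.continuous hψ0 hν
  set E : Set (Euc d × Euc d) := Prod.fst ⁻¹' tsupport ψ ∪ Prod.snd ⁻¹' tsupport ψ
  have hE : γ E ≤ μ (tsupport ψ) + ν (tsupport ψ) := by
    refine (measure_union_le _ _).trans_eq ?_
    rw [measure_preimage_eq_of_restrict_map_eq measurable_fst h₁ hS h0,
      measure_preimage_eq_of_restrict_map_eq measurable_snd h₂ hS h0]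
  rw [he₁, he₂, ← integral_sub hi₁ hi₂]
  have hvanish : ∀ q, q ∉ E → ψ q.1 - ψ q.2 = 0 := fun q hq => by
    have hq' : q.1 ∉ tsupport ψ ∧ q.2 ∉ tsupport ψ := by simpa [E] using hq
    rw [image_eq_zero_of_notMem_tsupport hq'.1, image_eq_zero_of_notMem_tsupport hq'.2, sub_zero]
  rw [← setIntegral_eq_integral_of_forall_compl_eq_zero hvanish]
  calc ‖∫ q in E, (ψ q.1 - ψ q.2) ∂γ‖ₑ
      ≤ ∫⁻ q in E, ‖ψ q.1 - ψ q.2‖ₑ ∂γ := enorm_integral_le_lintegral_enorm _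
    _ ≤ ∫⁻ q in E, K * ‖q.1 - q.2‖ₑ ∂γ := lintegral_mono fun q => by
        simpa only [edist_eq_enorm_sub] using hψ q.1 q.2
    _ = K * ∫⁻ q in E, ‖q.1 - q.2‖ₑ ∂γ := lintegral_const_mul _ (by fun_prop)
    _ ≤ K * (Jp p γ ^ (1 / p) * γ E ^ ((p - 1) / p)) := by
        gcongr
        exact setLIntegral_norm_sub_le hp γ E
    _ ≤ K * (Jp p γ ^ (1 / p) * (μ (tsupport ψ) + ν (tsupport ψ)) ^ ((p - 1) / p)) := by
        have : 0 ≤ (p - 1) / p := div_nonneg (by linarith) (by linarith)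
        gcongr
    _ = _ := by ring

lemma le_mul_dLpPow_rpow {d : ℕ} {p : ℝ} (hp : 0 < p) {μ ν : Measure (Euc d)} {a c : ℝ≥0∞}
    (hc : c ≠ ⊤) (hadm : (AdmPlan μ ν).Nonempty)
    (h : ∀ γ ∈ AdmPlan μ ν, a ≤ c * Jp p γ ^ (1 / p)) :
    a ≤ c * dLpPow p μ ν ^ (1 / p) := by
  rcases eq_or_ne c 0 with rfl | hc0
  · obtain ⟨γ, hγ⟩ := hadm
    simpa using h γ hγ
  have hdiv : a / c ≤ dLpPow p μ ν ^ (1 / p) := by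
    rw [one_div, ENNReal.le_rpow_inv_iff hp]
    refine le_iInf₂ fun γ hγ => ?_
    rw [← ENNReal.le_rpow_inv_iff hp, ← one_div]
    exact ENNReal.div_le_of_le_mul' (h γ hγ)
  rwa [ENNReal.div_le_iff' hc0 hc] at hdiv

/-- Proposition 3.9: for a Lipschitz function `ψ` with compact support in `B̄₁ ∖ {0}` and
measures `μ, ν ∈ 𝕃_p(B₁)`,
`|∫ ψ dμ - ∫ ψ dν| ≤ (μ(spt ψ) + ν(spt ψ))^{(p-1)/p} [ψ]_Lip d_{𝕃_p}(μ,ν)`. -/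
theorem lipschitz_test_function_bound
    {d : ℕ} (p : ℝ) (hp1 : 1 ≤ p) (hp2 : p ≤ 2)
    (ψ : Euc d → ℝ) (Kψ : ℝ≥0) (hψ : LipschitzWith Kψ ψ)
    (hψcpt : HasCompactSupport ψ)
    (hψsupp : tsupport ψ ⊆ closedBall (0 : Euc d) 1 \ {0})
    (μ ν : Measure (Euc d))
    (hμ : IsLevyLpOn p (ball (0 : Euc d) 1) μ) (hν : IsLevyLpOn p (ball (0 : Euc d) 1) ν) :
    |(∫ z in ball (0 : Euc d) 1, ψ z ∂μ) - ∫ z in ball (0 : Euc d) 1, ψ z ∂ν| ≤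
      ((μ (tsupport ψ) + ν (tsupport ψ)).toReal) ^ ((p - 1) / p) * (Kψ : ℝ) * dLp p μ ν := by
  have hp0 : 0 < p := by linarith
  have h0 : (0 : Euc d) ∉ tsupport ψ := fun h => (hψsupp h).2 rfl
  have hfin : ∀ {ρ : Measure (Euc d)}, IsLevyLpOn p (ball (0 : Euc d) 1) ρ →
      ρ (tsupport ψ) < ⊤ := fun hρ =>
    measure_lt_top_of_isCompact_of_isLevyLp hp0.le hρ.1 hψcpt h0
  have hint : ∀ {ρ : Measure (Euc d)}, IsLevyLpOn p (ball (0 : Euc d) 1) ρ →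
      Integrable ψ ρ := fun hρ =>
    (integrableOn_iff_integrable_of_support_subset (subset_tsupport ψ)).1
      (hψ.continuous.continuousOn.integrableOn_of_subset_isCompact hψcpt
        (isClosed_tsupport ψ).measurableSet subset_rfl (hfin hρ).ne)
  have hball : ∀ {ρ : Measure (Euc d)}, IsLevyLpOn p (ball (0 : Euc d) 1) ρ →
      ρ.restrict (ball (0 : Euc d) 1) = ρ := fun hρ =>
    Measure.restrict_eq_self_of_ae_mem hρ.2
  rw [hball hμ, hball hν]
  have hD := dLpPow_lt_top hp0.le hμ hν
  have hadm : (AdmPlan μ ν).Nonempty := by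
    by_contra hempty
    simp [dLpPow, not_nonempty_iff_eq_empty.1 hempty] at hD
  have hexp : 0 ≤ (p - 1) / p := div_nonneg (by linarith) hp0.le
  have hC : (μ (tsupport ψ) + ν (tsupport ψ)) ^ ((p - 1) / p) * (Kψ : ℝ≥0∞) ≠ ⊤ :=
    ENNReal.mul_ne_top (ENNReal.rpow_ne_top_of_nonneg hexp
      (ENNReal.add_lt_top.2 ⟨hfin hμ, hfin hν⟩).ne) ENNReal.coe_ne_top
  have key := le_mul_dLpPow_rpow hp0 hC hadm fun γ hγ =>
    enorm_integral_sub_le_of_mem_admPlan hp1 hψ h0 (hint hμ) (hint hν) hγ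
  have := ENNReal.toReal_mono (ENNReal.mul_ne_top hC
    (ENNReal.rpow_ne_top_of_nonneg (one_div_nonneg.2 hp0.le) hD.ne)) key
  simpa only [toReal_enorm, Real.norm_eq_abs, ENNReal.toReal_mul, ← ENNReal.toReal_rpow,
    ENNReal.coe_toReal, dLp] using this
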